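/- Let A ≥ 1, let (X,d) be an unbounded A-uniform metric space with d(x) > 0 for every x ∈ X, let k be its quasihyperbolic metric, and let p ∈ X. Then (x|y)^k_p → ∞ as x, y → ∞; i.e. for every M > 0 there exists R > 0 such that whenever x, y ∈ X satisfy d(x,p) ≥ R and d(y,p) ≥ R, one has (x|y)^k_p ≥ M. -/

import Mathlib

open Metric Filter Set

noncomputable section

universe u v

/-- Gromov product of `x` and `y` with respect to base point `w`,
for a real-valued distance kernel `ρ`. -/
def gromovProd {X : Type u} (ρ : X → X → ℝ) (w x y : X) : ℝ :=
  (ρ x w + ρ y w - ρ x y) / 2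

/-- `(X, ρ)` is δ-hyperbolic. -/
def IsDeltaHyp {X : Type u} (ρ : X → X → ℝ) (δ : ℝ) : Prop :=
  ∀ x y z w : X, gromovProd ρ w x y ≥ min (gromovProd ρ w x z) (gromovProd ρ w z y) - δ

/-- `f` is a (λ,μ)-rough similarity. -/
def RoughSimilarity {X : Type u} {Y : Type v} [MetricSpace X] [MetricSpace Y]
    (lam mu : ℝ) (f : X → Y) : Prop :=
  (∀ y : Y, ∃ x : X, dist y (f x) ≤ mu) ∧
  (∀ x x' : X, lam * dist x x' - mu ≤ dist (f x) (f x') ∧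
    dist (f x) (f x') ≤ lam * dist x x' + mu)

/-- The distance from `x ∈ X` to the metric boundary `∂X = X̄ \ X`. -/
def distToBdry (X : Type u) [MetricSpace X] (x : X) : ℝ :=
  Metric.infDist (x : UniformSpace.Completion X)
    (Set.range ((↑) : X → UniformSpace.Completion X))ᶜ

/-- `X` is noncomplete, i.e. `∂X = X̄ \ X ≠ ∅`. -/
def IsNoncomplete (X : Type u) [MetricSpace X] : Prop :=
  ((Set.range ((↑) : X → UniformSpace.Completion X))ᶜ).Nonempty

/-- Ibragimov's hyperbolization metric. -/
def hMetric (X : Type u) [MetricSpace X] (x y : X) : ℝ :=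
  2 * Real.log ((dist x y + max (distToBdry X x) (distToBdry X y)) /
    Real.sqrt (distToBdry X x * distToBdry X y))

/-- The j̃-metric. -/
def jtMetric (X : Type u) [MetricSpace X] (x y : X) : ℝ :=
  (1 / 2) * Real.log ((1 + dist x y / distToBdry X x) * (1 + dist x y / distToBdry X y))

/-- The quasihyperbolic metric. -/
def quasihyperbolic (X : Type u) [MetricSpace X] (x y : X) : ℝ :=
  sInf {r : ℝ | ∃ L : ℝ, 0 ≤ L ∧ ∃ γ : ℝ → X,
    LipschitzOnWith 1 γ (Set.Icc 0 L) ∧ γ 0 = x ∧ γ L = y ∧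
    r = ∫ t in (0:ℝ)..L, (distToBdry X (γ t))⁻¹}

/-- `X` is an `A`-uniform metric space. -/
def IsUniformMS (X : Type u) [MetricSpace X] (A : ℝ) : Prop :=
  ∀ x y : X, ∃ L : ℝ, 0 ≤ L ∧ ∃ γ : ℝ → X,
    LipschitzOnWith 1 γ (Set.Icc 0 L) ∧ γ 0 = x ∧ γ L = y ∧
    L ≤ A * dist x y ∧ ∀ t ∈ Set.Icc (0:ℝ) L, min t (L - t) ≤ A * distToBdry X (γ t)

/-- `X` is unbounded. -/
def IsUnbounded (X : Type u) [MetricSpace X] : Prop :=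
  ¬ Bornology.IsBounded (Set.univ : Set X)

/-- `γ` is a 1-Lipschitz curve from `x` to `y`, parametrized by `[0, L]`. -/
structure IsLipCurve {X : Type u} [MetricSpace X] (γ : ℝ → X) (L : ℝ) (x y : X) : Prop where
  nonneg : 0 ≤ L
  lip : LipschitzOnWith 1 γ (Icc 0 L)
  source : γ 0 = x
  target : γ L = y

/-- The quasihyperbolic length of `γ` on `[a, b]`. -/
def qhLength {X : Type u} [MetricSpace X] (γ : ℝ → X) (a b : ℝ) : ℝ :=
  ∫ t in a..b, (distToBdry X (γ t))⁻¹

section Basic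

variable {X : Type u} [MetricSpace X]

theorem distToBdry_le_add_dist (x y : X) : distToBdry X x ≤ distToBdry X y + dist x y := by
  have h := infDist_le_infDist_add_dist (s := (range ((↑) : X → UniformSpace.Completion X))ᶜ)
    (x := (x : UniformSpace.Completion X)) (y := (y : UniformSpace.Completion X))
  rwa [UniformSpace.Completion.dist_eq] at h

theorem continuous_distToBdry : Continuous (distToBdry X) :=
  (continuous_infDist_pt _).comp (UniformSpace.Completion.continuous_coe X)

theorem LipschitzOnWith.dist_le_abs_sub {γ : ℝ → X} {S : Set ℝ} (h : LipschitzOnWith 1 γ S)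
    {s t : ℝ} (hs : s ∈ S) (ht : t ∈ S) : dist (γ s) (γ t) ≤ |s - t| := by
  simpa [Real.dist_eq] using h.dist_le_mul s hs t ht

theorem LipschitzOnWith.intervalIntegrable_inv_distToBdry (hd : ∀ x : X, 0 < distToBdry X x)
    {γ : ℝ → X} {L : ℝ} (h : LipschitzOnWith 1 γ (Icc 0 L)) {a b : ℝ}
    (ha : a ∈ Icc 0 L) (hb : b ∈ Icc 0 L) :
    IntervalIntegrable (fun t => (distToBdry X (γ t))⁻¹) MeasureTheory.volume a b := by
  apply ContinuousOn.intervalIntegrable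
  apply ContinuousOn.inv₀
  · exact continuous_distToBdry.comp_continuousOn (h.continuousOn.mono (uIcc_subset_Icc ha hb))
  · exact fun t _ => (hd _).ne'

theorem LipschitzOnWith.qhLength_add (hd : ∀ x : X, 0 < distToBdry X x)
    {γ : ℝ → X} {L : ℝ} (h : LipschitzOnWith 1 γ (Icc 0 L)) {a b c : ℝ}
    (ha : a ∈ Icc 0 L) (hb : b ∈ Icc 0 L) (hc : c ∈ Icc 0 L) :
    qhLength γ a b + qhLength γ b c = qhLength γ a c :=
  intervalIntegral.integral_add_adjacent_intervals
    (h.intervalIntegrable_inv_distToBdry hd ha hb) (h.intervalIntegrable_inv_distToBdry hd hb hc)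

theorem qhLength_nonneg (hd : ∀ x : X, 0 < distToBdry X x) (γ : ℝ → X) {a b : ℝ} (hab : a ≤ b) :
    0 ≤ qhLength γ a b :=
  intervalIntegral.integral_nonneg hab fun _ _ => (inv_pos.2 (hd _)).le

theorem IsLipCurve.symm {γ : ℝ → X} {L : ℝ} {x y : X} (h : IsLipCurve γ L x y) :
    IsLipCurve (fun t => γ (L - t)) L y x where
  nonneg := h.nonneg
  lip := by
    refine LipschitzOnWith.of_dist_le_mul fun s hs t ht => ?_
    have := h.lip.dist_le_abs_sub (s := L - s) (t := L - t)
      ⟨by linarith [hs.2], by linarith [hs.1]⟩ ⟨by linarith [ht.2], by linarith [ht.1]⟩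
    rw [sub_sub_sub_cancel_left, abs_sub_comm] at this
    simpa [Real.dist_eq] using this
  source := by simpa using h.target
  target := by simpa using h.source

theorem qhLength_reverse (γ : ℝ → X) (L : ℝ) :
    qhLength (fun t => γ (L - t)) 0 L = qhLength γ 0 L := by
  simp [qhLength, intervalIntegral.integral_comp_sub_left (fun t => (distToBdry X (γ t))⁻¹) L]

theorem IsLipCurve.subcurve {γ : ℝ → X} {L : ℝ} {x y : X} (h : IsLipCurve γ L x y) {a b : ℝ}
    (ha : 0 ≤ a) (hab : a ≤ b) (hb : b ≤ L) :
    IsLipCurve (fun t => γ (t + a)) (b - a) (γ a) (γ b) where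
  nonneg := by linarith
  lip := by
    refine LipschitzOnWith.of_dist_le_mul fun s hs t ht => ?_
    have := h.lip.dist_le_abs_sub (s := s + a) (t := t + a)
      ⟨by linarith [hs.1], by linarith [hs.2]⟩ ⟨by linarith [ht.1], by linarith [ht.2]⟩
    rw [add_sub_add_right_eq_sub] at this
    simpa [Real.dist_eq] using this
  source := by simp
  target := by simp

theorem qhLength_subcurve (γ : ℝ → X) (a b : ℝ) :
    qhLength (fun t => γ (t + a)) 0 (b - a) = qhLength γ a b := by
  simp [qhLength, intervalIntegral.integral_comp_add_right (fun t => (distToBdry X (γ t))⁻¹) a]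

theorem IsLipCurve.trans {γ₁ γ₂ : ℝ → X} {L₁ L₂ : ℝ} {x y z : X} (h₁ : IsLipCurve γ₁ L₁ x y)
    (h₂ : IsLipCurve γ₂ L₂ y z) :
    IsLipCurve (fun t => if t ≤ L₁ then γ₁ t else γ₂ (t - L₁)) (L₁ + L₂) x z where
  nonneg := add_nonneg h₁.nonneg h₂.nonneg
  lip := by
    have mixed : ∀ s t : ℝ, 0 ≤ s → s ≤ L₁ → L₁ ≤ t → t ≤ L₁ + L₂ →
        dist (γ₁ s) (γ₂ (t - L₁)) ≤ |s - t| := by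
      intro s t hs0 hs ht ht2
      have e₁ := h₁.lip.dist_le_abs_sub (s := s) (t := L₁) ⟨hs0, hs⟩ ⟨h₁.nonneg, le_rfl⟩
      have e₂ := h₂.lip.dist_le_abs_sub (s := 0) (t := t - L₁) ⟨le_rfl, h₂.nonneg⟩
        ⟨by linarith, by linarith⟩
      rw [h₁.target, abs_of_nonpos (by linarith)] at e₁
      rw [h₂.source, abs_of_nonpos (by linarith)] at e₂
      rw [abs_of_nonpos (by linarith)]
      linarith [dist_triangle (γ₁ s) y (γ₂ (t - L₁))]
    refine LipschitzOnWith.of_dist_le_mul fun s hs t ht => ?_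
    rw [NNReal.coe_one, one_mul, Real.dist_eq]
    split_ifs with h h' h'
    · exact h₁.lip.dist_le_abs_sub ⟨hs.1, h⟩ ⟨ht.1, h'⟩
    · exact mixed s t hs.1 h (not_le.1 h').le ht.2
    · rw [dist_comm, abs_sub_comm]
      exact mixed t s ht.1 h' (not_le.1 h).le hs.2
    · have := h₂.lip.dist_le_abs_sub (s := s - L₁) (t := t - L₁)
        ⟨by linarith, by linarith [hs.2]⟩ ⟨by linarith, by linarith [ht.2]⟩
      rwa [sub_sub_sub_cancel_right] at this
  source := by simp [h₁.nonneg, h₁.source]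
  target := by
    split_ifs with h
    · have : L₂ = 0 := le_antisymm (by linarith) h₂.nonneg
      subst this
      rw [add_zero, h₁.target, ← h₂.source, h₂.target]
    · simpa using h₂.target

theorem IsLipCurve.qhLength_trans (hd : ∀ x : X, 0 < distToBdry X x)
    {γ₁ γ₂ : ℝ → X} {L₁ L₂ : ℝ} {x y z : X}
    (h₁ : IsLipCurve γ₁ L₁ x y) (h₂ : IsLipCurve γ₂ L₂ y z) :
    qhLength (fun t => if t ≤ L₁ then γ₁ t else γ₂ (t - L₁)) 0 (L₁ + L₂) =
      qhLength γ₁ 0 L₁ + qhLength γ₂ 0 L₂ := by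
  have n₁ := h₁.nonneg
  have n₂ := h₂.nonneg
  rw [← (h₁.trans h₂).lip.qhLength_add hd (b := L₁) ⟨le_rfl, by linarith⟩ ⟨n₁, by linarith⟩
    ⟨by linarith, le_rfl⟩]
  congr 1
  · refine intervalIntegral.integral_congr fun t ht => ?_
    rw [uIcc_of_le n₁] at ht
    simp [ht.2]
  · rw [← qhLength_subcurve _ L₁ (L₁ + L₂), add_sub_cancel_left]
    refine intervalIntegral.integral_congr fun t ht => ?_
    rw [uIcc_of_le n₂] at ht
    by_cases h : t = 0
    · simp [h, h₁.target, h₂.source]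
    · have : 0 < t := lt_of_le_of_ne ht.1 (Ne.symm h)
      simp [this.not_ge]

end Basic

section Quasihyperbolic

variable {X : Type u} [MetricSpace X]

theorem IsLipCurve.quasihyperbolic_le (hd : ∀ x : X, 0 < distToBdry X x) {γ : ℝ → X} {L : ℝ}
    {x y : X} (h : IsLipCurve γ L x y) : quasihyperbolic X x y ≤ qhLength γ 0 L := by
  refine csInf_le ⟨0, ?_⟩ ⟨L, h.nonneg, γ, h.lip, h.source, h.target, rfl⟩
  rintro r ⟨L', hL', γ', -, -, -, rfl⟩
  exact qhLength_nonneg hd γ' hL'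

theorem IsLipCurve.quasihyperbolic_le_qhLength (hd : ∀ x : X, 0 < distToBdry X x) {γ : ℝ → X}
    {L : ℝ} {x y : X} (h : IsLipCurve γ L x y) {a b : ℝ} (ha : 0 ≤ a) (hab : a ≤ b) (hb : b ≤ L) :
    quasihyperbolic X (γ a) (γ b) ≤ qhLength γ a b :=
  qhLength_subcurve γ a b ▸ (h.subcurve ha hab hb).quasihyperbolic_le hd

variable {A : ℝ}

theorem IsUniformMS.exists_isLipCurve (hXA : IsUniformMS X A) (x y : X) :
    ∃ γ L, IsLipCurve γ L x y ∧ L ≤ A * dist x y ∧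
      ∀ t ∈ Icc (0:ℝ) L, min t (L - t) ≤ A * distToBdry X (γ t) := by
  obtain ⟨L, h0, γ, h1, h2, h3, h4⟩ := hXA x y
  exact ⟨γ, L, ⟨h0, h1, h2, h3⟩, h4⟩

theorem IsUniformMS.exists_qhLength_lt (hXA : IsUniformMS X A) (x y : X) {ε : ℝ} (hε : 0 < ε) :
    ∃ γ L, IsLipCurve γ L x y ∧ qhLength γ 0 L < quasihyperbolic X x y + ε := by
  obtain ⟨γ, L, h, -⟩ := hXA.exists_isLipCurve x y
  obtain ⟨r, ⟨L', hL', γ', h1, h2, h3, rfl⟩, hr⟩ := exists_lt_of_csInf_lt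
    (s := {r : ℝ | ∃ L : ℝ, 0 ≤ L ∧ ∃ γ : ℝ → X, LipschitzOnWith 1 γ (Set.Icc 0 L) ∧
      γ 0 = x ∧ γ L = y ∧ r = ∫ t in (0:ℝ)..L, (distToBdry X (γ t))⁻¹})
    ⟨_, L, h.nonneg, γ, h.lip, h.source, h.target, rfl⟩
    (lt_add_of_pos_right (quasihyperbolic X x y) hε)
  exact ⟨γ', L', ⟨hL', h1, h2, h3⟩, hr⟩

theorem IsUniformMS.quasihyperbolic_triangle (hXA : IsUniformMS X A)
    (hd : ∀ x : X, 0 < distToBdry X x) (x y z : X) :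
    quasihyperbolic X x z ≤ quasihyperbolic X x y + quasihyperbolic X y z := by
  refine le_of_forall_pos_le_add fun ε hε => ?_
  obtain ⟨γ₁, L₁, h₁, e₁⟩ := hXA.exists_qhLength_lt x y (half_pos hε)
  obtain ⟨γ₂, L₂, h₂, e₂⟩ := hXA.exists_qhLength_lt y z (half_pos hε)
  have := (h₁.trans h₂).quasihyperbolic_le hd
  rw [h₁.qhLength_trans hd h₂] at this
  linarith

theorem IsUniformMS.quasihyperbolic_comm (hXA : IsUniformMS X A)
    (hd : ∀ x : X, 0 < distToBdry X x) (x y : X) :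
    quasihyperbolic X x y = quasihyperbolic X y x := by
  have key : ∀ x y : X, quasihyperbolic X x y ≤ quasihyperbolic X y x := by
    intro x y
    refine le_of_forall_pos_le_add fun ε hε => ?_
    obtain ⟨γ, L, h, e⟩ := hXA.exists_qhLength_lt y x hε
    have := h.symm.quasihyperbolic_le hd
    rw [qhLength_reverse] at this
    linarith
  exact le_antisymm (key x y) (key y x)

theorem integral_inv_add {m L : ℝ} (hm : 0 < m) (hL : 0 ≤ L) :
    ∫ t in (0:ℝ)..L, (m + t)⁻¹ = Real.log ((m + L) / m) := by
  rw [intervalIntegral.integral_comp_add_left (fun t => t⁻¹) m,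
    integral_inv_of_pos (by linarith) (by linarith), add_zero]

theorem intervalIntegrable_inv_add {m L : ℝ} (hm : 0 < m) (hL : 0 ≤ L) :
    IntervalIntegrable (fun t => (m + t)⁻¹) MeasureTheory.volume 0 L := by
  apply ContinuousOn.intervalIntegrable
  refine ContinuousOn.inv₀ (by fun_prop) fun t ht => ?_
  rw [uIcc_of_le hL] at ht
  linarith [ht.1]

theorem IsUniformMS.log_div_le_quasihyperbolic (hXA : IsUniformMS X A)
    (hd : ∀ x : X, 0 < distToBdry X x) (x y : X) :
    Real.log (distToBdry X y / distToBdry X x) ≤ quasihyperbolic X x y := by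
  refine le_of_forall_pos_le_add fun ε hε => ?_
  obtain ⟨γ, L, h, e⟩ := hXA.exists_qhLength_lt x y hε
  have h0 : (0:ℝ) ∈ Icc 0 L := ⟨le_rfl, h.nonneg⟩
  have hle : ∀ t ∈ Icc 0 L, distToBdry X (γ t) ≤ distToBdry X x + t := by
    intro t ht
    have := h.lip.dist_le_abs_sub ht h0
    rw [h.source, sub_zero, abs_of_nonneg ht.1] at this
    linarith [distToBdry_le_add_dist (γ t) x]
  refine le_trans ?_ e.le
  calc Real.log (distToBdry X y / distToBdry X x)
      ≤ Real.log ((distToBdry X x + L) / distToBdry X x) := by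
        have := hle L ⟨h.nonneg, le_rfl⟩
        rw [h.target] at this
        have h1 := hd x
        have h2 := hd y
        gcongr
    _ = ∫ t in (0:ℝ)..L, (distToBdry X x + t)⁻¹ := (integral_inv_add (hd x) h.nonneg).symm
    _ ≤ qhLength γ 0 L := by
        refine intervalIntegral.integral_mono_on h.nonneg (intervalIntegrable_inv_add (hd x) h.nonneg)
          (h.lip.intervalIntegrable_inv_distToBdry hd h0 ⟨h.nonneg, le_rfl⟩) fun t ht => ?_
        exact inv_anti₀ (hd _) (hle t ht)

theorem IsUniformMS.quasihyperbolic_le_log (hXA : IsUniformMS X A) (hA : 1 ≤ A)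
    (hd : ∀ x : X, 0 < distToBdry X x) {x y : X} {m : ℝ} (hm : 0 < m)
    (hx : m ≤ distToBdry X x) (hy : m ≤ distToBdry X y) :
    quasihyperbolic X x y ≤ 2 * (1 + 2 * A) * Real.log (1 + A * (dist x y / m)) := by
  obtain ⟨γ, L, h, hL, hmin⟩ := hXA.exists_isLipCurve x y
  have n := h.nonneg
  have h0 : (0:ℝ) ∈ Icc 0 L := ⟨le_rfl, n⟩
  have h1 : L ∈ Icc 0 L := ⟨n, le_rfl⟩
  have i₁ := intervalIntegrable_inv_add hm n
  have i₂ : IntervalIntegrable (fun t => (m + (L - t))⁻¹) MeasureTheory.volume 0 L := by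
    have := (i₁.comp_sub_left L).symm
    simpa using this
  have bound : ∀ t ∈ Icc 0 L, (distToBdry X (γ t))⁻¹ ≤
      (1 + 2 * A) * ((m + t)⁻¹ + (m + (L - t))⁻¹) := by
    intro t ht
    have a := h.lip.dist_le_abs_sub h0 ht
    have b := h.lip.dist_le_abs_sub h1 ht
    rw [h.source, zero_sub, abs_neg, abs_of_nonneg ht.1] at a
    rw [h.target, abs_of_nonneg (by linarith [ht.2])] at b
    have a' := distToBdry_le_add_dist x (γ t)
    have b' := distToBdry_le_add_dist y (γ t)
    have c := hmin t ht
    have ht1 := ht.1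
    have ht2 := ht.2
    have gen : ∀ s, 0 ≤ s → m - s ≤ distToBdry X (γ t) → s ≤ A * distToBdry X (γ t) →
        (distToBdry X (γ t))⁻¹ ≤ (1 + 2 * A) * (m + s)⁻¹ := by
      intro s hs q1 q2
      have hD := hd (γ t)
      rw [← div_eq_mul_inv, inv_eq_one_div, div_le_div_iff₀ hD (by linarith)]
      nlinarith
    have p1 : 0 ≤ (m + t)⁻¹ := by positivity
    have p2 : 0 ≤ (m + (L - t))⁻¹ := inv_nonneg.2 (by linarith)
    rw [mul_add]
    rcases le_total t (L - t) with hc | hc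
    · rw [min_eq_left hc] at c
      have := gen t ht1 (by linarith) c
      have : 0 ≤ (1 + 2 * A) * (m + (L - t))⁻¹ := mul_nonneg (by linarith) p2
      linarith
    · rw [min_eq_right hc] at c
      have := gen (L - t) (by linarith) (by linarith) c
      have : 0 ≤ (1 + 2 * A) * (m + t)⁻¹ := mul_nonneg (by linarith) p1
      linarith
  calc quasihyperbolic X x y ≤ qhLength γ 0 L := h.quasihyperbolic_le hd
    _ ≤ ∫ t in (0:ℝ)..L, (1 + 2 * A) * ((m + t)⁻¹ + (m + (L - t))⁻¹) :=
        intervalIntegral.integral_mono_on n (h.lip.intervalIntegrable_inv_distToBdry hd h0 h1)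
          ((i₁.add i₂).const_mul _) bound
    _ = 2 * (1 + 2 * A) * Real.log ((m + L) / m) := by
        rw [intervalIntegral.integral_const_mul, intervalIntegral.integral_add i₁ i₂,
          intervalIntegral.integral_comp_sub_left (fun t => (m + t)⁻¹) L, sub_self, sub_zero,
          integral_inv_add hm n]
        ring
    _ ≤ 2 * (1 + 2 * A) * Real.log (1 + A * (dist x y / m)) := by
        have : (m + L) / m ≤ 1 + A * (dist x y / m) := by
          rw [add_div, div_self hm.ne', ← mul_div_assoc]
          gcongr
        gcongr

/-- Curves whose quasihyperbolic length exceeds the quasihyperbolic distance of the endpoints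
by at most `1` have the same property for all their subcurves. -/
theorem IsUniformMS.qhLength_le_of_qhLength_le (hXA : IsUniformMS X A)
    (hd : ∀ x : X, 0 < distToBdry X x) {γ : ℝ → X} {L : ℝ} {x y : X} (h : IsLipCurve γ L x y)
    (hopt : qhLength γ 0 L ≤ quasihyperbolic X x y + 1) {a b : ℝ}
    (ha : 0 ≤ a) (hab : a ≤ b) (hb : b ≤ L) :
    qhLength γ a b ≤ quasihyperbolic X (γ a) (γ b) + 1 := by
  have n := h.nonneg
  have e1 := h.quasihyperbolic_le_qhLength hd le_rfl ha (hab.trans hb)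
  have e2 := h.quasihyperbolic_le_qhLength hd (ha.trans hab) hb le_rfl
  rw [h.source] at e1
  rw [h.target] at e2
  have t1 := hXA.quasihyperbolic_triangle hd x (γ a) y
  have t2 := hXA.quasihyperbolic_triangle hd (γ a) (γ b) y
  have s1 := h.lip.qhLength_add hd (a := 0) (b := a) (c := L) ⟨le_rfl, n⟩ ⟨ha, hab.trans hb⟩
    ⟨n, le_rfl⟩
  have s2 := h.lip.qhLength_add hd (a := a) (b := b) (c := L) ⟨ha, hab.trans hb⟩
    ⟨ha.trans hab, hb⟩ ⟨n, le_rfl⟩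
  linarith

theorem exists_forall_le_of_le_log {A B : ℝ} (hA : 0 < A) (hB : 0 < B) :
    ∃ C > 0, ∀ τ : ℝ, 0 ≤ τ → τ ≤ B * Real.log (1 + A * τ) + 1 → τ ≤ C := by
  set c : ℝ := 2 * A * B with hc
  have hc0 : 0 < c := by positivity
  refine ⟨max 1 (2 * (B * (1 / c + Real.log c) + 1)), by positivity, fun τ hτ h => ?_⟩
  refine le_max_of_le_right ?_
  have hw : 0 < 1 + A * τ := by positivity
  have hlog := Real.log_le_sub_one_of_pos (div_pos hw hc0)
  rw [Real.log_div hw.ne' hc0.ne'] at hlog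
  have h2 : B * Real.log (1 + A * τ) ≤ B * ((1 + A * τ) / c + Real.log c) := by
    gcongr
    linarith
  have h3 : B * ((1 + A * τ) / c) = B * (1 / c) + τ / 2 := by
    rw [hc]
    field_simp
  linarith

/-- First hitting times of a continuous function. -/
theorem exists_first_hitting {f : ℝ → ℝ} {T v : ℝ} (hT : 0 ≤ T) (hf : ContinuousOn f (Icc 0 T))
    (h0 : f 0 ≤ v) (h1 : v ≤ f T) :
    ∃ s ∈ Icc 0 T, f s = v ∧ ∀ t ∈ Icc 0 s, f t ≤ v := by
  have hcl : IsCompact (Icc 0 T ∩ f ⁻¹' Ici v) :=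
    isCompact_Icc.of_isClosed_subset (hf.preimage_isClosed_of_isClosed isClosed_Icc isClosed_Ici)
      inter_subset_left
  obtain ⟨s, hs, hmin⟩ := hcl.exists_isLeast ⟨T, ⟨hT, le_rfl⟩, h1⟩
  have hsv : f s = v := by
    obtain ⟨t, ht, rfl⟩ := intermediate_value_Icc hs.1.1 (hf.mono (Icc_subset_Icc_right hs.1.2))
      ⟨h0, hs.2⟩
    have := hmin ⟨⟨ht.1, ht.2.trans hs.1.2⟩, le_refl (f t)⟩
    rw [le_antisymm ht.2 this]
  refine ⟨s, hs.1, hsv, fun t ht => ?_⟩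
  by_contra! hlt
  have := hmin ⟨⟨ht.1, ht.2.trans hs.1.2⟩, hlt.le⟩
  rw [le_antisymm ht.2 this] at hlt
  exact hlt.ne' hsv

/-- In a uniform space, almost optimal quasihyperbolic curves move away from their starting point
by at most a multiple of the largest distance to the boundary reached. -/
theorem IsUniformMS.exists_dist_le_mul_distToBdry (hXA : IsUniformMS X A) (hA : 1 ≤ A)
    (hd : ∀ x : X, 0 < distToBdry X x) :
    ∃ C > 0, ∀ (γ : ℝ → X) (L : ℝ) (x y : X), IsLipCurve γ L x y →
      qhLength γ 0 L ≤ quasihyperbolic X x y + 1 → ∀ T ∈ Icc 0 L,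
      (∀ t ∈ Icc 0 T, distToBdry X (γ t) ≤ distToBdry X (γ T)) →
      dist x (γ T) ≤ C * distToBdry X (γ T) := by
  obtain ⟨C, hC, hCle⟩ := exists_forall_le_of_le_log (A := 2 * A) (B := 2 * (1 + 2 * A))
    (by linarith) (by linarith)
  refine ⟨2 * C, by linarith, fun γ L x y h hopt => ?_⟩
  have n := h.nonneg
  have single : ∀ s T, 0 ≤ s → s ≤ T → T ≤ L →
      (∀ t ∈ Icc s T, distToBdry X (γ t) ≤ distToBdry X (γ T)) →
      distToBdry X (γ T) ≤ 2 * distToBdry X (γ s) →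
      dist (γ s) (γ T) ≤ C * distToBdry X (γ T) := by
    intro s T hs hsT hT hmax hdouble
    have hD := hd (γ T)
    rw [← div_le_iff₀ hD]
    apply hCle _ (by positivity)
    have hsI : s ∈ Icc 0 L := ⟨hs, hsT.trans hT⟩
    have hTI : T ∈ Icc 0 L := ⟨hs.trans hsT, hT⟩
    have e1 : dist (γ s) (γ T) / distToBdry X (γ T) ≤ qhLength γ s T := by
      have hdist := h.lip.dist_le_abs_sub hsI hTI
      rw [abs_sub_comm, abs_of_nonneg (by linarith)] at hdist
      calc dist (γ s) (γ T) / distToBdry X (γ T) ≤ (T - s) * (distToBdry X (γ T))⁻¹ := by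
            rw [div_eq_mul_inv]
            gcongr
        _ = ∫ _ in s..T, (distToBdry X (γ T))⁻¹ := by simp
        _ ≤ qhLength γ s T :=
            intervalIntegral.integral_mono_on hsT intervalIntegrable_const
              (h.lip.intervalIntegrable_inv_distToBdry hd hsI hTI)
              fun t ht => inv_anti₀ (hd _) (hmax t ht)
    have e2 := hXA.qhLength_le_of_qhLength_le hd h hopt hs hsT hT
    have e3 := hXA.quasihyperbolic_le_log hA hd (x := γ s) (y := γ T) (half_pos hD)
      (by linarith) (by linarith)
    have e4 : A * (dist (γ s) (γ T) / (distToBdry X (γ T) / 2)) =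
        2 * A * (dist (γ s) (γ T) / distToBdry X (γ T)) := by
      field_simp
    rw [e4] at e3
    linarith
  have main : ∀ k : ℕ, ∀ T ∈ Icc 0 L, distToBdry X (γ T) ≤ 2 ^ k * distToBdry X x →
      (∀ t ∈ Icc 0 T, distToBdry X (γ t) ≤ distToBdry X (γ T)) →
      dist x (γ T) ≤ 2 * C * distToBdry X (γ T) := by
    intro k
    induction k with
    | zero =>
      intro T hT hk hmax
      have hx := hd x
      have := single 0 T le_rfl hT.1 hT.2 hmax (by rw [h.source]; linarith)
      rw [h.source] at this
      nlinarith [hd (γ T)]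
    | succ k ih =>
      intro T hT hk hmax
      have hD := hd (γ T)
      rcases le_total (distToBdry X (γ T) / 2) (distToBdry X x) with hle | hle
      · have := single 0 T le_rfl hT.1 hT.2 hmax (by rw [h.source]; linarith)
        rw [h.source] at this
        nlinarith
      · obtain ⟨s, hs, hsv, hsmax⟩ := exists_first_hitting (f := fun t => distToBdry X (γ t)) hT.1
          (continuous_distToBdry.comp_continuousOn
            (h.lip.continuousOn.mono (Icc_subset_Icc_right hT.2)))
          (v := distToBdry X (γ T) / 2) (by simpa [h.source] using hle) (by linarith)
        have e1 := ih s ⟨hs.1, hs.2.trans hT.2⟩ (by rw [pow_succ] at hk; linarith)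
          (by rwa [hsv])
        have e2 := single s T hs.1 hs.2 hT.2 (fun t ht => hmax t ⟨hs.1.trans ht.1, ht.2⟩)
          (by linarith)
        have := dist_triangle x (γ s) (γ T)
        rw [hsv] at e1
        linarith
  intro T hT hmax
  obtain ⟨k, hk⟩ := pow_unbounded_of_one_lt (distToBdry X (γ T) / distToBdry X x)
    (one_lt_two : (1:ℝ) < 2)
  exact main k T hT ((div_le_iff₀ (hd x)).1 hk.le) hmax

/-- In a uniform space, a point `x` far from `p` can be joined to `p` almost optimally through a
point at height `D` whose distance to `p` is comparable to `D`. -/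
theorem IsUniformMS.exists_intermediate (hXA : IsUniformMS X A) (hA : 1 ≤ A)
    (hd : ∀ x : X, 0 < distToBdry X x) :
    ∃ C > 0, ∀ (p x : X) (D : ℝ), distToBdry X p ≤ D → 2 * C * D ≤ dist p x →
      ∃ z : X, distToBdry X z = D ∧ dist p z ≤ C * D ∧
        quasihyperbolic X p z + quasihyperbolic X z x ≤ quasihyperbolic X p x + 1 := by
  obtain ⟨C, hC, hesc⟩ := hXA.exists_dist_le_mul_distToBdry hA hd
  refine ⟨C, hC, fun p x D hD hfar => ?_⟩
  obtain ⟨γ, L, h, hopt⟩ := hXA.exists_qhLength_lt p x one_pos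
  have n := h.nonneg
  have hcont : ContinuousOn (fun t => distToBdry X (γ t)) (Icc 0 L) :=
    continuous_distToBdry.comp_continuousOn h.lip.continuousOn
  obtain ⟨T, hT, hTmax⟩ := isCompact_Icc.exists_isMaxOn ⟨0, le_rfl, n⟩ hcont
  have e1 := hesc γ L p x h hopt.le T hT fun t ht => hTmax ⟨ht.1, ht.2.trans hT.2⟩
  have e2 := hesc _ L x p h.symm
    (by rw [qhLength_reverse, hXA.quasihyperbolic_comm hd x p]; exact hopt.le) (L - T)
    ⟨by linarith [hT.2], by linarith [hT.1]⟩ (fun t ht => by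
      rw [sub_sub_cancel]
      exact hTmax ⟨by linarith [ht.2, hT.1], by linarith [ht.1]⟩)
  rw [sub_sub_cancel, dist_comm] at e2
  have hDT : D ≤ distToBdry X (γ T) := by
    have := dist_triangle p (γ T) x
    have : C * D ≤ C * distToBdry X (γ T) := by linarith
    exact le_of_mul_le_mul_left this hC
  obtain ⟨s, hs, hsv, hsmax⟩ := exists_first_hitting hT.1 (hcont.mono (Icc_subset_Icc_right hT.2))
    (by simpa [h.source] using hD) hDT
  have hsL : s ∈ Icc 0 L := ⟨hs.1, hs.2.trans hT.2⟩
  refine ⟨γ s, hsv, hsv ▸ hesc γ L p x h hopt.le s hsL (by rwa [hsv]), ?_⟩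
  have q1 := h.quasihyperbolic_le_qhLength hd le_rfl hs.1 hsL.2
  have q2 := h.quasihyperbolic_le_qhLength hd hs.1 hsL.2 le_rfl
  rw [h.source] at q1
  rw [h.target] at q2
  have := h.lip.qhLength_add hd (a := 0) (b := s) (c := L) ⟨le_rfl, n⟩ hsL ⟨n, le_rfl⟩
  linarith

end Quasihyperbolic

/-- quasihyperbolic Gromov products blow up at infinity in an
unbounded uniform space. -/
theorem quasihyperbolic_gromovProd_tendsto_atTop_at_infinity
    {X : Type u} [MetricSpace X] (A : ℝ) (hA : 1 ≤ A)
    (hub : IsUnbounded X) (hXA : IsUniformMS X A)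
    (hd : ∀ x : X, 0 < distToBdry X x) (p : X) :
    ∀ M > (0:ℝ), ∃ R > (0:ℝ), ∀ x y : X,
      dist x p ≥ R → dist y p ≥ R →
      gromovProd (quasihyperbolic X) p x y ≥ M := by
  intro M hM
  obtain ⟨C, hC, hmid⟩ := hXA.exists_intermediate hA hd
  set E : ℝ := 2 * (1 + 2 * A) * Real.log (1 + A * (2 * C)) with hE
  have hE0 : 0 ≤ E := mul_nonneg (by linarith) (Real.log_nonneg (by nlinarith))
  set N : ℝ := M + 1 + E / 2 with hN
  set D : ℝ := distToBdry X p * Real.exp N with hDdef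
  have hp := hd p
  have hD0 : 0 < D := by positivity
  have hpD : distToBdry X p ≤ D :=
    le_mul_of_one_le_right hp.le (Real.one_le_exp (by linarith))
  refine ⟨2 * C * D, by positivity, fun x y hx hy => ?_⟩
  rw [ge_iff_le, dist_comm] at hx hy
  obtain ⟨x', hx'D, hx'p, hx'⟩ := hmid p x D hpD hx
  obtain ⟨y', hy'D, hy'p, hy'⟩ := hmid p y D hpD hy
  have low : ∀ z, distToBdry X z = D → N ≤ quasihyperbolic X p z := by
    intro z hz
    have := hXA.log_div_le_quasihyperbolic hd p z
    rwa [hz, hDdef, mul_div_cancel_left₀ _ hp.ne', Real.log_exp] at this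
  have hx'y' : quasihyperbolic X x' y' ≤ E := by
    refine (hXA.quasihyperbolic_le_log hA hd hD0 hx'D.ge hy'D.ge).trans ?_
    have : dist x' y' / D ≤ 2 * C := by
      rw [div_le_iff₀ hD0]
      linarith [dist_triangle_left x' y' p]
    rw [hE]
    gcongr
  have t1 := hXA.quasihyperbolic_triangle hd x x' y
  have t2 := hXA.quasihyperbolic_triangle hd x' y' y
  rw [hXA.quasihyperbolic_comm hd x x'] at t1
  rw [gromovProd, hXA.quasihyperbolic_comm hd x p, hXA.quasihyperbolic_comm hd y p]
  linarith [low x' hx'D, low y' hy'D]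

end
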